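/- arXiv:2511.06877 — 5 statements merged into one kernel-verified Lean document; each statement's English description precedes it below -/
import Mathlib

section
/- Let B₁, B₂, B₃ be Banach spaces, where B₁ is reflexive in the sense that the canonical isometric embedding of B₁ into its double dual is surjective. Let T : B₁ → B₃ be a compact continuous linear map and let S : B₁ → B₂ be a continuous injective linear map. Then for every ε > 0 there exists a constant C_ε > 0 such that ‖T x‖ ≤ ε ‖x‖ + C_ε ‖S x‖ for all x ∈ B₁. (Ehrling's inequality.) -/
open Filter Topology in
/-- In a reflexive space every bounded family converges weakly along any ultrafilter. -/
theorem exists_forall_tendsto_dual_of_surjective_inclusionInDoubleDual {ι E : Type*}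
    [NormedAddCommGroup E] [NormedSpace ℝ E]
    (hrefl : Function.Surjective (NormedSpace.inclusionInDoubleDual ℝ E))
    (u : ι → E) {r : ℝ} (hu : ∀ i, ‖u i‖ ≤ r) (l : Ultrafilter ι) :
    ∃ x : E, ∀ f : E →L[ℝ] ℝ, Tendsto (fun i => f (u i)) l (𝓝 (f x)) := by
  let J : E → WeakDual ℝ (StrongDual ℝ E) := fun x =>
    StrongDual.toWeakDual (NormedSpace.inclusionInDoubleDual ℝ E x)
  have hmem : ∀ i, J (u i) ∈ WeakDual.toStrongDual ⁻¹'
      Metric.closedBall (0 : StrongDual ℝ (StrongDual ℝ E)) r := by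
    intro i
    exact (mem_closedBall_zero_iff (a := NormedSpace.inclusionInDoubleDual ℝ E (u i))).2
      ((NormedSpace.double_dual_bound ℝ E (u i)).trans (hu i))
  obtain ⟨φ, -, hφ⟩ := (WeakDual.isCompact_closedBall (𝕜 := ℝ)
    (0 : StrongDual ℝ (StrongDual ℝ E)) r).ultrafilter_le_nhds (l.map fun i => J (u i))
    (le_principal_iff.2 (Eventually.of_forall hmem : ∀ᶠ i in (l : Filter ι), _))
  obtain ⟨x, hx⟩ := hrefl (WeakDual.toStrongDual φ)
  refine ⟨x, fun f => ?_⟩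
  have h : Tendsto (fun i => J (u i) f) l (𝓝 (φ f)) :=
    ((WeakDual.eval_continuous f).tendsto φ).comp hφ
  have hφx : φ f = f x := by
    rw [← NormedSpace.dual_def ℝ E x f, hx]
    rfl
  rwa [hφx] at h

open Filter Topology in
/-- If `u` tends weakly to `x` and `T ∘ u` tends in norm to `y`, then `y = T x`. -/
theorem ContinuousLinearMap.apply_eq_of_forall_tendsto_dual {ι E F : Type*}
    [NormedAddCommGroup E] [NormedSpace ℝ E] [NormedAddCommGroup F] [NormedSpace ℝ F]
    {l : Filter ι} [l.NeBot] {u : ι → E} {x : E} {y : F}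
    (hu : ∀ f : E →L[ℝ] ℝ, Tendsto (fun i => f (u i)) l (𝓝 (f x)))
    (T : E →L[ℝ] F) (hy : Tendsto (fun i => T (u i)) l (𝓝 y)) : T x = y := by
  refine (SeparatingDual.eq_iff_forall_dual_eq (R := ℝ)).2 fun g => ?_
  exact tendsto_nhds_unique (hu (g.comp T)) ((g.continuous.tendsto y).comp hy)

open Filter Topology in
/-- Ehrling's inequality: if `B₁` is a reflexive Banach space, `T : B₁ → B₃` is a
compact operator and `S : B₁ → B₂` is a continuous injection, then for every `ε > 0`
there is `C_ε > 0` with `‖T x‖ ≤ ε ‖x‖ + C_ε ‖S x‖` for all `x`. -/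
theorem stmt1 {B₁ B₂ B₃ : Type*}
    [NormedAddCommGroup B₁] [NormedSpace ℝ B₁] [CompleteSpace B₁]
    [NormedAddCommGroup B₂] [NormedSpace ℝ B₂] [CompleteSpace B₂]
    [NormedAddCommGroup B₃] [NormedSpace ℝ B₃] [CompleteSpace B₃]
    (hrefl : Function.Surjective (NormedSpace.inclusionInDoubleDual ℝ B₁))
    (T : B₁ →L[ℝ] B₃) (hT : IsCompactOperator T)
    (S : B₁ →L[ℝ] B₂) (hS : Function.Injective S) :
    ∀ ε > 0, ∃ C > 0, ∀ x : B₁, ‖T x‖ ≤ ε * ‖x‖ + C * ‖S x‖ := by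
  intro ε hε
  by_contra! hcon
  have hunit : ∀ n : ℕ, ∃ x : B₁, ‖x‖ = 1 ∧ ε + (n + 1) * ‖S x‖ < ‖T x‖ := by
    intro n
    obtain ⟨x, hx⟩ := hcon (n + 1) (by positivity)
    have hx0 : x ≠ 0 := by
      rintro rfl
      simp at hx
    have hpos : 0 < ‖x‖ := norm_pos_iff.2 hx0
    refine ⟨‖x‖⁻¹ • x, norm_smul_inv_norm (𝕜 := ℝ) hx0, ?_⟩
    simp only [map_smul, norm_smul, norm_inv, norm_norm]
    calc ε + (n + 1) * (‖x‖⁻¹ * ‖S x‖) = ‖x‖⁻¹ * (ε * ‖x‖ + (n + 1) * ‖S x‖) := by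
          field_simp
      _ < ‖x‖⁻¹ * ‖T x‖ := by gcongr
  choose u hu1 hu using hunit
  obtain ⟨x, hx⟩ := exists_forall_tendsto_dual_of_surjective_inclusionInDoubleDual hrefl u
    (fun n => (hu1 n).le) (hyperfilter ℕ)
  have hle : (hyperfilter ℕ : Filter ℕ) ≤ atTop := Nat.hyperfilter_le_atTop
  have hSu : Tendsto (fun n => S (u n)) (hyperfilter ℕ) (𝓝 0) := by
    refine squeeze_zero_norm (a := fun n : ℕ => ‖T‖ * (1 / ((n : ℝ) + 1))) (fun n => ?_) ?_
    · have hTu : ‖T (u n)‖ ≤ ‖T‖ := by simpa [hu1 n] using T.le_opNorm (u n)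
      rw [mul_one_div, le_div_iff₀ (by positivity)]
      linarith [hu n]
    · simpa using (tendsto_one_div_add_atTop_nhds_zero_nat (𝕜 := ℝ)).const_mul ‖T‖ |>.mono_left hle
  have hx0 : x = 0 :=
    hS ((S.apply_eq_of_forall_tendsto_dual hx hSu).trans (map_zero S).symm)
  obtain ⟨K, hK, hTK⟩ := IsCompactOperator.image_closedBall_subset_compact (𝕜₁ := ℝ)
    (f := (T : B₁ →ₗ[ℝ] B₃)) hT 1
  have hmem : ∀ n, T (u n) ∈ K := fun n =>
    hTK ⟨u n, mem_closedBall_zero_iff.2 (hu1 n).le, rfl⟩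
  obtain ⟨y, -, hy⟩ := hK.ultrafilter_le_nhds ((hyperfilter ℕ).map fun n => T (u n))
    (le_principal_iff.2 (Eventually.of_forall hmem : ∀ᶠ n in (hyperfilter ℕ : Filter ℕ), _))
  have hTu : Tendsto (fun n => T (u n)) (hyperfilter ℕ) (𝓝 y) := hy
  have hy0 : y = 0 := by
    rw [← T.apply_eq_of_forall_tendsto_dual hx hTu, hx0, map_zero]
  have hεy : ε ≤ ‖y‖ := ge_of_tendsto' hTu.norm fun n =>
    (le_add_of_nonneg_right (by positivity)).trans (hu n).le
  rw [hy0, norm_zero] at hεy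
  exact hεy.not_gt hε
end

section
/- Fix a real number t and an integer k ≥ 1. The function W : (0,∞) → ℝ defined by W(r) = e^{−t r²/2} · r^{−2k} · ( e^{t r²} · Σ_{j=0}^k (−t r²)^j/j! − 1 ) satisfies the ordinary differential equation r² W''(r) = (4k + 2 k t r² + t² r⁴) W(r) + r (1 − 2k) W'(r) for every r > 0. -/
open Finset in
/-- The function `W` appearing in the magnetic Steklov computation on the unit disk. -/
noncomputable def stmt6W (t : ℝ) (k : ℕ) (r : ℝ) : ℝ :=
  Real.exp (-t * r ^ 2 / 2) / r ^ (2 * k) *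
    (Real.exp (t * r ^ 2) * ∑ j ∈ Finset.range (k + 1), (-(t * r ^ 2)) ^ j / (Nat.factorial j)
      - 1)

/-- The derivative of the truncated exponential series of `-(t * x ^ 2)`. -/
theorem hasDerivAt_sum_neg_mul_sq_pow_div_factorial (t : ℝ) (k : ℕ) (x : ℝ) :
    HasDerivAt
      (fun x : ℝ => ∑ j ∈ Finset.range (k + 1), (-(t * x ^ 2)) ^ j / (Nat.factorial j : ℝ))
      (2 * t * x * ((-(t * x ^ 2)) ^ k / (Nat.factorial k : ℝ)
        - ∑ j ∈ Finset.range (k + 1), (-(t * x ^ 2)) ^ j / (Nat.factorial j : ℝ))) x := by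
  induction k with
  | zero => simpa using hasDerivAt_const x (1 : ℝ)
  | succ k ih =>
    have hs : HasDerivAt (fun x : ℝ => -(t * x ^ 2)) (-(2 * t * x)) x := by
      refine (((hasDerivAt_pow 2 x).const_mul t).neg).congr_deriv ?_
      push_cast
      ring
    have hpow := (hs.pow (k + 1)).div_const (Nat.factorial (k + 1) : ℝ)
    simp only [Finset.sum_range_succ _ (k + 1)]
    refine (ih.add hpow).congr_deriv ?_
    rw [Nat.factorial_succ]
    have hk : (Nat.factorial k : ℝ) ≠ 0 := by positivity
    have hk' : (k : ℝ) + 1 ≠ 0 := by positivity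
    push_cast
    field_simp
    ring

/-- `stmt6W t k` satisfies a first-order linear inhomogeneous equation. -/
theorem hasDerivAt_stmt6W (t : ℝ) (k : ℕ) {x : ℝ} (hx : x ≠ 0) :
    HasDerivAt (stmt6W t k)
      (-(2 * k / x + t * x) * stmt6W t k x
        + 2 * t * ((-t) ^ k / (Nat.factorial k : ℝ)) * (x * Real.exp (t * x ^ 2 / 2))) x := by
  have hB : HasDerivAt (fun x : ℝ => Real.exp (-t * x ^ 2 / 2))
      (Real.exp (-t * x ^ 2 / 2) * (-(t * x))) x := by
    refine (((hasDerivAt_pow 2 x).const_mul (-t)).div_const 2).exp.congr_deriv ?_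
    push_cast
    ring
  have hE : HasDerivAt (fun x : ℝ => Real.exp (t * x ^ 2))
      (Real.exp (t * x ^ 2) * (2 * t * x)) x := by
    refine ((hasDerivAt_pow 2 x).const_mul t).exp.congr_deriv ?_
    push_cast
    ring
  have hP : HasDerivAt (fun x : ℝ => x ^ (2 * k)) (2 * k * x ^ (2 * k) / x) x := by
    refine (hasDerivAt_pow (2 * k) x).congr_deriv ?_
    rcases k with _ | k
    · simp
    · rw [show 2 * (k + 1) = 2 * k + 1 + 1 by ring, Nat.add_sub_cancel]
      push_cast
      field_simp
      ring
  have hW := (hB.div hP (pow_ne_zero _ hx)).mul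
    ((hE.mul (hasDerivAt_sum_neg_mul_sq_pow_div_factorial t k x)).sub_const 1)
  refine HasDerivAt.congr_deriv (f := stmt6W t k) hW ?_
  have hexp : Real.exp (t * x ^ 2 / 2) = Real.exp (-t * x ^ 2 / 2) * Real.exp (t * x ^ 2) := by
    rw [← Real.exp_add]
    ring_nf
  have hpow : (-(t * x ^ 2)) ^ k = (-t) ^ k * x ^ (2 * k) := by
    rw [pow_mul, ← mul_pow]
    ring
  have hx' : x ^ (2 * k) ≠ 0 := pow_ne_zero _ hx
  have hk : (Nat.factorial k : ℝ) ≠ 0 := by positivity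
  simp only [stmt6W, Pi.mul_apply, Pi.div_apply]
  rw [hexp, hpow]
  generalize ∑ j ∈ Finset.range (k + 1), (-(t * x ^ 2)) ^ j / (Nat.factorial j : ℝ) = S
  generalize Real.exp (-t * x ^ 2 / 2) = B
  generalize Real.exp (t * x ^ 2) = E
  generalize x ^ (2 * k) = p at *
  generalize (-t) ^ k = c
  field_simp
  ring

/-- For `k ≥ 1`, the function
`W(r) = e^{−t r²/2} r^{−2k} (e^{t r²} Σ_{j=0}^k (−t r²)^j/j! − 1)` satisfies the ODE
`r² W'' = (4k + 2ktr² + t²r⁴) W + r(1 − 2k) W'` on `(0, ∞)`. -/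
theorem stmt6 (t : ℝ) (k : ℕ) (hk : 1 ≤ k) (r : ℝ) (hr : 0 < r) :
    r ^ 2 * deriv (deriv (stmt6W t k)) r
      = (4 * k + 2 * k * t * r ^ 2 + t ^ 2 * r ^ 4) * stmt6W t k r
        + r * (1 - 2 * (k : ℝ)) * deriv (stmt6W t k) r := by
  have hr0 := hr.ne'
  have hW := hasDerivAt_stmt6W t k hr0
  have hderiv : deriv (stmt6W t k) =ᶠ[nhds r] fun x =>
      -(2 * k / x + t * x) * stmt6W t k x
        + 2 * t * ((-t) ^ k / (Nat.factorial k : ℝ)) * (x * Real.exp (t * x ^ 2 / 2)) := by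
    filter_upwards [isOpen_ne.mem_nhds hr0] with x hx
    exact (hasDerivAt_stmt6W t k hx).deriv
  have hE : HasDerivAt (fun x : ℝ => Real.exp (t * x ^ 2 / 2))
      (Real.exp (t * r ^ 2 / 2) * (t * r)) r := by
    refine (((hasDerivAt_pow 2 r).const_mul t).div_const 2).exp.congr_deriv ?_
    push_cast
    ring
  have hcoef : HasDerivAt (fun x : ℝ => -(2 * k / x + t * x)) (2 * k / r ^ 2 - t) r := by
    refine ((((hasDerivAt_const r (2 * k : ℝ)).div (hasDerivAt_id r) hr0).add
      ((hasDerivAt_id r).const_mul t)).neg).congr_deriv ?_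
    simp only [id]
    ring
  have hW2 := (hcoef.mul hW).add
    (((hasDerivAt_id r).mul hE).const_mul (2 * t * ((-t) ^ k / (Nat.factorial k : ℝ))))
  have hsecond := hderiv.deriv_eq.trans hW2.deriv
  rw [hsecond, hW.deriv]
  simp only [id]
  generalize (-t) ^ k / (Nat.factorial k : ℝ) = c
  field_simp
  ring
end

section
/- Fix a real number t > 0 and an integer k ≥ 1. Set D = Σ_{j=0}^k (−t)^j/j! − e^{−t} (which is nonzero), and define Q : (0,∞) → ℝ by Q(r) = (r^k e^{t(r²−1)/2})/2 + e^{t(r²−1)/2} · ( Σ_{j=0}^k (−t r²)^j/j! − e^{−t r²} ) / (2 r^k D). Then Q(1) = 1 and Q'(1) = (−t)^{k+1} / ( k! · ( e^{−t} − Σ_{j=0}^k (−t)^j/j! ) ). -/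
/-- The radial part `Q` of the `η`-harmonic extension of `i e^{ikθ} dθ` on the unit
disk, for the magnetic potential `tη`. -/
noncomputable def stmt8Q (t : ℝ) (k : ℕ) (r : ℝ) : ℝ :=
  r ^ k * Real.exp (t * (r ^ 2 - 1) / 2) / 2 +
    Real.exp (t * (r ^ 2 - 1) / 2) *
        ((∑ j ∈ Finset.range (k + 1), (-(t * r ^ 2)) ^ j / (Nat.factorial j))
          - Real.exp (-(t * r ^ 2))) /
      (2 * r ^ k *
        ((∑ j ∈ Finset.range (k + 1), (-t) ^ j / (Nat.factorial j)) - Real.exp (-t)))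

open Finset in
theorem hasDerivAt_sum_pow_div_factorial (n : ℕ) (x : ℝ) :
    HasDerivAt (fun y : ℝ => ∑ j ∈ range (n + 1), y ^ j / (Nat.factorial j))
      (∑ j ∈ range n, x ^ j / (Nat.factorial j)) x := by
  induction n with
  | zero => simpa using hasDerivAt_const x (1 : ℝ)
  | succ n ih =>
    have h := ih.add ((hasDerivAt_pow (n + 1) x).div_const ((n + 1).factorial : ℝ))
    have e : ((n + 1 : ℕ) : ℝ) * x ^ (n + 1 - 1) / ((n + 1).factorial : ℝ)
        = x ^ n / (n.factorial : ℝ) := by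
      rw [Nat.factorial_succ]
      push_cast
      field_simp
    rw [e, ← sum_range_succ] at h
    refine h.congr_of_eventuallyEq (Filter.Eventually.of_forall fun y => ?_)
    simp only [Pi.add_apply]
    exact sum_range_succ _ _

open Finset in
/-- The partial sums of the exponential series at `-x` alternately over- and underestimate
`exp (-x)`. -/
theorem neg_one_pow_mul_sum_sub_exp_neg_pos (n : ℕ) {x : ℝ} (hx : 0 < x) :
    0 < (-1) ^ n * ((∑ j ∈ range (n + 1), (-x) ^ j / (Nat.factorial j)) - Real.exp (-x)) := by
  induction n generalizing x with
  | zero => simpa using hx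
  | succ n ih =>
    have hderiv (y : ℝ) : HasDerivAt (fun y : ℝ => (-1) ^ (n + 1) *
        ((∑ j ∈ range (n + 1 + 1), (-y) ^ j / (Nat.factorial j)) - Real.exp (-y)))
        ((-1) ^ n * ((∑ j ∈ range (n + 1), (-y) ^ j / (Nat.factorial j)) - Real.exp (-y))) y := by
      have h := (((hasDerivAt_sum_pow_div_factorial (n + 1) (-y)).sub
        (Real.hasDerivAt_exp (-y))).comp y (hasDerivAt_neg y)).const_mul ((-1 : ℝ) ^ (n + 1))
      exact h.congr_deriv (by ring)
    have hmono := strictMonoOn_of_deriv_pos (convex_Ici (0 : ℝ))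
      (fun y _ => (hderiv y).continuousAt.continuousWithinAt)
      (fun y hy => by
        rw [interior_Ici] at hy
        rw [(hderiv y).deriv]
        exact ih hy)
    have h := hmono Set.self_mem_Ici hx.le hx
    simpa [sum_range_succ' _ (n + 1)] using h

/-- For `t > 0` and `k ≥ 1`, the denominator
`D = Σ_{j=0}^k (−t)^j/j! − e^{−t}` is nonzero, `Q(1) = 1`, and
`Q'(1) = (−t)^{k+1} / (k! (e^{−t} − Σ_{j=0}^k (−t)^j/j!))`, the eigenvalue of the
magnetic Steklov operator. -/
theorem stmt8 (t : ℝ) (ht : 0 < t) (k : ℕ) (hk : 1 ≤ k) :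
    ((∑ j ∈ Finset.range (k + 1), (-t) ^ j / (Nat.factorial j)) - Real.exp (-t)) ≠ 0 ∧
    stmt8Q t k 1 = 1 ∧
    deriv (stmt8Q t k) 1
      = (-t) ^ (k + 1) /
        ((Nat.factorial k) *
          (Real.exp (-t) - ∑ j ∈ Finset.range (k + 1), (-t) ^ j / (Nat.factorial j))) := by
  set D := (∑ j ∈ Finset.range (k + 1), (-t) ^ j / (Nat.factorial j : ℝ)) - Real.exp (-t) with hD
  have hD0 : D ≠ 0 := right_ne_zero_of_mul (neg_one_pow_mul_sum_sub_exp_neg_pos k ht).ne'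
  refine ⟨hD0, ?_, ?_⟩
  · simp only [stmt8Q, one_pow, mul_one, sub_self, mul_zero, zero_div, Real.exp_zero, one_mul]
    rw [← hD]
    field_simp
    norm_num
  · have hS : (∑ j ∈ Finset.range k, (-t) ^ j / (Nat.factorial j : ℝ)) - Real.exp (-t)
        = D - (-t) ^ k / (Nat.factorial k : ℝ) := by
      rw [hD, Finset.sum_range_succ]
      ring
    have hsq : HasDerivAt (fun r : ℝ => r ^ 2) 2 1 := by
      simpa using hasDerivAt_pow 2 (1 : ℝ)
    have hpow : HasDerivAt (fun r : ℝ => r ^ k) k 1 := by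
      simpa using hasDerivAt_pow k (1 : ℝ)
    have hexp : HasDerivAt (fun r : ℝ => Real.exp (t * (r ^ 2 - 1) / 2)) t 1 := by
      have h := (((hsq.sub_const 1).const_mul t).div_const 2).exp
      exact h.congr_deriv (by simp)
    have htail : HasDerivAt (fun r : ℝ =>
        (∑ j ∈ Finset.range (k + 1), (-(t * r ^ 2)) ^ j / (Nat.factorial j : ℝ))
          - Real.exp (-(t * r ^ 2)))
        ((D - (-t) ^ k / (Nat.factorial k : ℝ)) * -(t * 2)) 1 := by
      have h := ((hasDerivAt_sum_pow_div_factorial k (-(t * 1 ^ 2))).sub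
        (Real.hasDerivAt_exp (-(t * 1 ^ 2)))).comp (1 : ℝ) (hsq.const_mul t).neg
      exact h.congr_deriv (by rw [← hS]; simp)
    have hQ := ((hpow.mul hexp).div_const 2).add
      ((hexp.mul htail).div ((hpow.const_mul 2).mul_const D) (by simpa using hD0))
    have hk0 : (Nat.factorial k : ℝ) ≠ 0 := Nat.cast_ne_zero.mpr k.factorial_ne_zero
    have hneg : Real.exp (-t) - ∑ j ∈ Finset.range (k + 1), (-t) ^ j / (Nat.factorial j : ℝ)
        = -D := by
      rw [hD]
      ring
    refine (HasDerivAt.deriv (f := stmt8Q t k) hQ).trans ?_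
    simp only [Pi.mul_apply, one_pow, mul_one, sub_self, mul_zero, zero_div, Real.exp_zero,
      one_mul]
    rw [hneg, ← hD]
    field_simp
    ring
end

section
/- For every real number t > 0 and every integer k ≥ 1, both denominators e^t − 1 − t and e^t − Σ_{j=0}^k t^j/j! are strictly positive, and t² / (e^t − 1 − t) ≤ t^{k+1} / ( k! · ( e^t − Σ_{j=0}^k t^j/j! ) ). -/
open Nat in
theorem factorial_mul_factorial_add_two_le (m k : ℕ) (hk : 1 ≤ k) :
    k ! * (m + 2)! ≤ (m + (k + 1))! := by
  induction k, hk using Nat.le_induction with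
  | base => simp
  | succ k _ ih =>
    calc (k + 1)! * (m + 2)! = (k + 1) * (k ! * (m + 2)!) := by
          rw [Nat.factorial_succ, mul_assoc]
      _ ≤ (m + (k + 1) + 1) * (m + (k + 1))! := Nat.mul_le_mul (by lia) ih
      _ = (m + (k + 1 + 1))! := (Nat.factorial_succ _).symm

/-- The Taylor remainder of the exponential is the sum of the tail of its series. -/
theorem hasSum_exp_sub_sum_range (t : ℝ) (n : ℕ) :
    HasSum (fun m : ℕ => t ^ (m + n) / (Nat.factorial (m + n) : ℝ))
      (Real.exp t - ∑ j ∈ Finset.range n, t ^ j / (Nat.factorial j : ℝ)) := by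
  have h := NormedSpace.expSeries_div_hasSum_exp t
  rw [← Real.exp_eq_exp_ℝ] at h
  exact (hasSum_nat_add_iff' n).mpr h

theorem exp_sub_sum_range_pos {t : ℝ} (ht : 0 < t) (n : ℕ) :
    0 < Real.exp t - ∑ j ∈ Finset.range n, t ^ j / (Nat.factorial j : ℝ) := by
  have h := Real.sum_le_exp_of_nonneg ht.le (n + 1)
  rw [Finset.sum_range_succ] at h
  have : 0 < t ^ n / (Nat.factorial n : ℝ) := by positivity
  linarith

/-- For `t > 0` and `k ≥ 1`, both `e^t − 1 − t` and `e^t − Σ_{j=0}^k t^j/j!` are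
positive, and the lowest magnetic Steklov eigenvalue `t²/(e^t − 1 − t)` satisfies
`t²/(e^t − 1 − t) ≤ t^{k+1}/(k! (e^t − Σ_{j=0}^k t^j/j!))`. -/
theorem stmt13 (t : ℝ) (ht : 0 < t) (k : ℕ) (hk : 1 ≤ k) :
    0 < Real.exp t - 1 - t ∧
    0 < Real.exp t - ∑ j ∈ Finset.range (k + 1), t ^ j / (Nat.factorial j) ∧
    t ^ 2 / (Real.exp t - 1 - t) ≤
      t ^ (k + 1) /
        ((Nat.factorial k) *
          (Real.exp t - ∑ j ∈ Finset.range (k + 1), t ^ j / (Nat.factorial j))) := by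
  have hsum : Real.exp t - ∑ j ∈ Finset.range 2, t ^ j / (Nat.factorial j : ℝ)
      = Real.exp t - 1 - t := by
    simp [Finset.sum_range_succ]
    ring
  have hpos := exp_sub_sum_range_pos ht 2
  have hposk := exp_sub_sum_range_pos ht (k + 1)
  have h2 := (hasSum_exp_sub_sum_range t 2).mul_left (t ^ (k + 1))
  have hk' := (hasSum_exp_sub_sum_range t (k + 1)).mul_left (t ^ 2 * (Nat.factorial k : ℝ))
  rw [hsum] at hpos h2
  refine ⟨hpos, hposk, ?_⟩
  rw [div_le_div_iff₀ hpos (by positivity), ← mul_assoc]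
  refine hasSum_le (fun m => ?_) hk' h2
  have hfac : (Nat.factorial k * Nat.factorial (m + 2) : ℝ) ≤ Nat.factorial (m + (k + 1)) :=
    mod_cast factorial_mul_factorial_add_two_le m k hk
  rw [← mul_div_assoc, ← mul_div_assoc, div_le_div_iff₀ (by positivity) (by positivity)]
  calc t ^ 2 * Nat.factorial k * t ^ (m + (k + 1)) * Nat.factorial (m + 2)
      = t ^ (m + k + 3) * (Nat.factorial k * Nat.factorial (m + 2)) := by ring
    _ ≤ t ^ (m + k + 3) * Nat.factorial (m + (k + 1)) := by gcongr
    _ = t ^ (k + 1) * t ^ (m + 2) * Nat.factorial (m + (k + 1)) := by ring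
end

section
/- For every real number t > 0 and every integer k ≥ 1: t² / (e^t − 1 − t) ≤ (−t)^{k+1} / ( k! · ( e^{−t} − Σ_{j=0}^k (−t)^j/j! ) ) (both sides being positive real numbers), and moreover t² / (e^t − 1 − t) < t · cosh(t/2)/sinh(t/2). -/
/-- The sign-normalised remainder of order `k` of the Taylor expansion of `exp (-t)` at `0`. -/
noncomputable def expNegRemainder (k : ℕ) (t : ℝ) : ℝ :=
  (-1) ^ (k + 1) * (Real.exp (-t) - ∑ j ∈ Finset.range (k + 1), (-t) ^ j / (Nat.factorial j))

theorem expNegRemainder_succ (k : ℕ) (t : ℝ) :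
    expNegRemainder (k + 1) t = t ^ (k + 1) / (Nat.factorial (k + 1)) - expNegRemainder k t := by
  have h : ((-1 : ℝ) ^ (k + 1)) * (-1) ^ (k + 1) = 1 := by rw [← mul_pow]; simp
  unfold expNegRemainder
  rw [Finset.sum_range_succ _ (k + 1), neg_pow t (k + 1), pow_succ (-1 : ℝ) (k + 1)]
  linear_combination (t ^ (k + 1) / (Nat.factorial (k + 1))) * h

theorem expNegRemainder_zero_right (k : ℕ) : expNegRemainder k 0 = 0 := by
  simp [expNegRemainder, Finset.sum_range_succ']

theorem hasDerivAt_expNegRemainder_zero (t : ℝ) :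
    HasDerivAt (expNegRemainder 0) (Real.exp (-t)) t := by
  have h : expNegRemainder 0 = fun x => 1 - Real.exp (-x) := by
    ext x; simp [expNegRemainder]
  rw [h]
  simpa using ((hasDerivAt_neg t).exp).const_sub 1

theorem hasDerivAt_expNegRemainder_succ (k : ℕ) (t : ℝ) :
    HasDerivAt (expNegRemainder (k + 1)) (expNegRemainder k t) t := by
  have hpow (n : ℕ) : HasDerivAt (fun x : ℝ => x ^ (n + 1) / (Nat.factorial (n + 1)))
      (t ^ n / (Nat.factorial n)) t := by
    refine ((hasDerivAt_pow (n + 1) t).div_const _).congr_deriv ?_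
    rw [Nat.factorial_succ]
    push_cast
    field_simp
  induction k with
  | zero =>
    rw [funext (expNegRemainder_succ 0)]
    refine ((hpow 0).sub (hasDerivAt_expNegRemainder_zero t)).congr_deriv ?_
    simp [expNegRemainder]
  | succ k ih =>
    rw [funext (expNegRemainder_succ (k + 1)), expNegRemainder_succ k t]
    exact (hpow (k + 1)).sub ih

theorem pos_of_hasDerivAt_pos {f f' : ℝ → ℝ} (hf : ∀ x, HasDerivAt f (f' x) x) (h0 : f 0 = 0)
    (hf' : ∀ x, 0 < x → 0 < f' x) {t : ℝ} (ht : 0 < t) : 0 < f t := by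
  have hmono : StrictMonoOn f (Set.Ici 0) := by
    refine strictMonoOn_of_deriv_pos (convex_Ici 0)
      (fun x _ => (hf x).continuousAt.continuousWithinAt) fun x hx => ?_
    rw [interior_Ici] at hx
    rw [(hf x).deriv]
    exact hf' x hx
  simpa [h0] using hmono Set.self_mem_Ici ht.le ht

theorem expNegRemainder_pos (k : ℕ) {t : ℝ} (ht : 0 < t) : 0 < expNegRemainder k t := by
  induction k generalizing t with
  | zero =>
    exact pos_of_hasDerivAt_pos hasDerivAt_expNegRemainder_zero (expNegRemainder_zero_right 0)
      (fun x _ => Real.exp_pos _) ht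
  | succ k ih =>
    exact pos_of_hasDerivAt_pos (hasDerivAt_expNegRemainder_succ k)
      (expNegRemainder_zero_right (k + 1)) (fun x hx => ih hx) ht

theorem expNegRemainder_lt (k : ℕ) {t : ℝ} (ht : 0 < t) :
    expNegRemainder k t < t ^ (k + 1) / (Nat.factorial (k + 1)) := by
  have h := expNegRemainder_pos (k + 1) ht
  rw [expNegRemainder_succ] at h
  linarith

theorem neg_pow_div_eq_div_expNegRemainder (k : ℕ) (t : ℝ) :
    (-t) ^ (k + 1) / ((Nat.factorial k) *
      (Real.exp (-t) - ∑ j ∈ Finset.range (k + 1), (-t) ^ j / (Nat.factorial j))) =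
    t ^ (k + 1) / ((Nat.factorial k) * expNegRemainder k t) := by
  have h : ((-1 : ℝ) ^ (k + 1)) * (-1) ^ (k + 1) = 1 := by rw [← mul_pow]; simp
  have h0 : ((-1 : ℝ) ^ (k + 1)) ≠ 0 := by positivity
  rw [← mul_div_mul_left _ _ h0, neg_pow t, ← mul_assoc, h, one_mul, expNegRemainder,
    mul_left_comm]

theorem add_one_lt_div_expNegRemainder (k : ℕ) {t : ℝ} (ht : 0 < t) :
    (k : ℝ) + 1 < t ^ (k + 1) / ((Nat.factorial k) * expNegRemainder k t) := by
  have hpos := expNegRemainder_pos k ht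
  have hlt := expNegRemainder_lt k ht
  rw [lt_div_iff₀ (by positivity), Nat.factorial_succ] at hlt
  rw [lt_div_iff₀ (by positivity)]
  push_cast at hlt
  linarith

theorem sq_div_exp_sub_lt_two {t : ℝ} (ht : 0 < t) : t ^ 2 / (Real.exp t - 1 - t) < 2 := by
  have h := Real.sum_le_exp_of_nonneg ht.le 4
  simp only [Finset.sum_range_succ, Finset.sum_range_zero, Nat.factorial] at h
  norm_num at h
  have h3 : 0 < t ^ 3 := by positivity
  have h2 : 0 < t ^ 2 := by positivity
  rw [div_lt_iff₀ (by linarith)]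
  linarith

theorem sq_div_exp_sub_lt_mul_cosh_div_sinh {t : ℝ} (ht : 0 < t) :
    t ^ 2 / (Real.exp t - 1 - t) < t * Real.cosh (t / 2) / Real.sinh (t / 2) := by
  have hden : 0 < Real.exp t - 1 - t := by linarith [Real.add_one_lt_exp ht.ne']
  have hsinh : 0 < Real.sinh (t / 2) := Real.sinh_pos_iff.2 (by linarith)
  have hself := Real.self_lt_sinh_iff.2 ht
  rw [div_lt_div_iff₀ hden hsinh]
  have ha : Real.exp t = Real.exp (t / 2) ^ 2 := by rw [← Real.exp_nat_mul]; congr 1; ring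
  have hb : Real.exp (-t) = Real.exp (-(t / 2)) ^ 2 := by
    rw [← Real.exp_nat_mul]; congr 1; ring
  have hab : Real.exp (t / 2) * Real.exp (-(t / 2)) = 1 := by rw [← Real.exp_add]; simp
  have hapos := Real.exp_pos (t / 2)
  rw [Real.sinh_eq, ha, hb] at hself
  rw [Real.cosh_eq, Real.sinh_eq, ha]
  generalize Real.exp (t / 2) = a at *
  generalize Real.exp (-(t / 2)) = b at *
  have key : 0 < t * a * ((a ^ 2 - b ^ 2) / 2 - t) :=
    mul_pos (mul_pos ht hapos) (sub_pos.2 hself)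
  linear_combination key - (t / 2) * (a + b) * hab


/-- For `t > 0` and `k ≥ 1`, the lowest magnetic Steklov eigenvalue
`t²/(e^t − 1 − t)` satisfies
`t²/(e^t − 1 − t) ≤ (−t)^{k+1}/(k! (e^{−t} − Σ_{j=0}^k (−t)^j/j!))`
(both sides being positive real numbers), and moreover
`t²/(e^t − 1 − t) < t cosh(t/2)/sinh(t/2)`. -/
theorem stmt14 (t : ℝ) (ht : 0 < t) (k : ℕ) (hk : 1 ≤ k) :
    0 < t ^ 2 / (Real.exp t - 1 - t) ∧
    0 < (-t) ^ (k + 1) /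
        ((Nat.factorial k) *
          (Real.exp (-t) - ∑ j ∈ Finset.range (k + 1), (-t) ^ j / (Nat.factorial j))) ∧
    t ^ 2 / (Real.exp t - 1 - t) ≤
      (-t) ^ (k + 1) /
        ((Nat.factorial k) *
          (Real.exp (-t) - ∑ j ∈ Finset.range (k + 1), (-t) ^ j / (Nat.factorial j))) ∧
    t ^ 2 / (Real.exp t - 1 - t) < t * Real.cosh (t / 2) / Real.sinh (t / 2) := by
  have hlt := add_one_lt_div_expNegRemainder k ht
  have hk' : (1 : ℝ) ≤ k := by exact_mod_cast hk
  rw [neg_pow_div_eq_div_expNegRemainder]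
  have hden : 0 < Real.exp t - 1 - t := by linarith [Real.add_one_lt_exp ht.ne']
  exact ⟨by positivity, by linarith, by linarith [sq_div_exp_sub_lt_two ht],
    sq_div_exp_sub_lt_mul_cosh_div_sinh ht⟩
end
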